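/- Let p, q be positive integers and x, z ∈ S_∞. If x ≤ z in the Bruhat order, then ε_{p,q}(x) ≤ ε_{p,q}(z) in the Bruhat order. -/

import Mathlib

/-- `S_∞`: a permutation of the positive integers lies in `S_∞` iff it
fixes all but finitely many integers. -/
def finSupp (w : Equiv.Perm ℕ+) : Prop := {i : ℕ+ | w i ≠ i}.Finite

/-- The length `ℓ(w) = #{(i,j) : i < j and w(i) > w(j)}`. -/
noncomputable def len (w : Equiv.Perm ℕ+) : ℕ :=
  {p : ℕ+ × ℕ+ | p.1 < p.2 ∧ w p.2 < w p.1}.ncard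

/-- Cover relation of the `k`-Bruhat order: `w = u∘(a,b)` with `a ≤ k < b`
and `ℓ(w) = ℓ(u) + 1`. -/
def kBruhatCover (k : ℕ) (u w : Equiv.Perm ℕ+) : Prop :=
  ∃ a b : ℕ+, (a : ℕ) ≤ k ∧ k < (b : ℕ) ∧ w = u * Equiv.swap a b ∧ len w = len u + 1

/-- The `k`-Bruhat order `≤_k`: reflexive–transitive closure of the cover relation. -/
def kBruhatLE (k : ℕ) : Equiv.Perm ℕ+ → Equiv.Perm ℕ+ → Prop :=
  Relation.ReflTransGen (kBruhatCover k)

/-- Cover relation of the Bruhat order on `S_∞`. -/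
def bruhatCover (u w : Equiv.Perm ℕ+) : Prop :=
  ∃ a b : ℕ+, a ≠ b ∧ w = u * Equiv.swap a b ∧ len w = len u + 1

/-- The Bruhat order on `S_∞`. -/
def bruhatLE : Equiv.Perm ℕ+ → Equiv.Perm ℕ+ → Prop :=
  Relation.ReflTransGen bruhatCover

/-- `isEps p q w w'` says `w' = ε_{p,q}(w)`. -/
def isEps (p q : ℕ+) (w w' : Equiv.Perm ℕ+) : Prop :=
  (∀ j : ℕ+, j < p → (w j < q → w' j = w j) ∧ (q ≤ w j → w' j = w j + 1)) ∧
  w' p = q ∧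
  (∀ j : ℕ+, p < j → (w (j - 1) < q → w' j = w (j - 1)) ∧ (q ≤ w (j - 1) → w' j = w (j - 1) + 1))

/-- The increasing bijection from the positive integers onto the positive integers other
than `p`. -/
def skip (p j : ℕ+) : ℕ+ := if j < p then j else j + 1

theorem skip_lt_skip {p i j : ℕ+} : skip p i < skip p j ↔ i < j := by
  unfold skip
  simp only [← PNat.coe_lt_coe] at *
  split_ifs <;> simp only [PNat.add_coe, PNat.one_coe] <;> omega

theorem skip_strictMono (p : ℕ+) : StrictMono (skip p) := fun _ _ => skip_lt_skip.2

theorem skip_ne (p j : ℕ+) : skip p j ≠ p := by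
  unfold skip
  split_ifs with h
  · exact h.ne
  · exact (PNat.lt_add_one_iff.2 (not_lt.1 h)).ne'

theorem PNat.sub_one_add_one_of_lt {p j : ℕ+} (h : p < j) : j - 1 + 1 = j :=
  PNat.sub_add_of_lt (lt_of_le_of_lt one_le h)

theorem skip_sub_one {p j : ℕ+} (h : p < j) : skip p (j - 1) = j := by
  have h1 := PNat.sub_one_add_one_of_lt h
  have h2 : ¬ j - 1 < p := by
    rw [not_lt, ← PNat.lt_add_one_iff, h1]
    exact h
  rw [skip, if_neg h2, h1]

theorem eq_or_exists_skip (p j : ℕ+) : j = p ∨ ∃ i, j = skip p i := by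
  rcases lt_trichotomy j p with h | h | h
  · exact Or.inr ⟨j, by simp [skip, h]⟩
  · exact Or.inl h
  · exact Or.inr ⟨j - 1, (skip_sub_one h).symm⟩

theorem isEps_iff {p q : ℕ+} {w w' : Equiv.Perm ℕ+} :
    isEps p q w w' ↔ w' p = q ∧ ∀ j, w' (skip p j) = skip q (w j) := by
  constructor
  · rintro ⟨h1, h2, h3⟩
    refine ⟨h2, fun j => ?_⟩
    by_cases hj : j < p
    · rw [skip, if_pos hj, skip]
      split_ifs with h
      · exact (h1 j hj).1 h
      · exact (h1 j hj).2 (not_lt.1 h)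
    · rw [skip, if_neg hj, skip]
      have hp : p < j + 1 := PNat.lt_add_one_iff.2 (not_lt.1 hj)
      have hs : j + 1 - 1 = j := PNat.add_sub
      have := h3 (j + 1) hp
      rw [hs] at this
      split_ifs with h
      · exact this.1 h
      · exact this.2 (not_lt.1 h)
  · rintro ⟨h2, h⟩
    refine ⟨fun j hj => ?_, h2, fun j hj => ?_⟩
    · have := h j
      rw [skip, if_pos hj, skip] at this
      exact ⟨fun hq => by rw [this, if_pos hq], fun hq => by rw [this, if_neg (not_lt.2 hq)]⟩
    · have := h (j - 1)
      rw [skip_sub_one hj, skip] at this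
      exact ⟨fun hq => by rw [this, if_pos hq], fun hq => by rw [this, if_neg (not_lt.2 hq)]⟩

theorem isEps.right_unique {p q : ℕ+} {w u v : Equiv.Perm ℕ+} (hu : isEps p q w u)
    (hv : isEps p q w v) : u = v := by
  rw [isEps_iff] at hu hv
  ext1 j
  rcases eq_or_exists_skip p j with rfl | ⟨i, rfl⟩
  · rw [hu.1, hv.1]
  · rw [hu.2, hv.2]

theorem isEps.mul_swap {p q : ℕ+} {w w' : Equiv.Perm ℕ+} (h : isEps p q w w') (a b : ℕ+) :
    isEps p q (w * Equiv.swap a b) (w' * Equiv.swap (skip p a) (skip p b)) := by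
  rw [isEps_iff] at h ⊢
  constructor
  · rw [Equiv.Perm.mul_apply,
      Equiv.swap_apply_of_ne_of_ne (skip_ne p a).symm (skip_ne p b).symm, h.1]
  · intro j
    rw [Equiv.Perm.mul_apply, Equiv.Perm.mul_apply,
      ← (skip_strictMono p).injective.map_swap, h.2]

theorem finSupp.exists_bound {w : Equiv.Perm ℕ+} (hw : finSupp w) :
    ∃ N, ∀ j, N < j → w j = j := by
  obtain ⟨N, hN⟩ := hw.bddAbove
  exact ⟨N, fun j hj => by
    by_contra hne
    exact absurd (hN hne) (not_le.2 hj)⟩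

theorem finSupp_of_bound {w : Equiv.Perm ℕ+} {N : ℕ+} (h : ∀ j, N < j → w j = j) :
    finSupp w :=
  (Set.finite_Iic N).subset fun j hj => by
    by_contra hne
    exact hj (h j (not_le.1 hne))

theorem finSupp.isEps {p q : ℕ+} {w w' : Equiv.Perm ℕ+} (hw : finSupp w)
    (h : isEps p q w w') : finSupp w' := by
  obtain ⟨N, hN⟩ := hw.exists_bound
  refine finSupp_of_bound (N := N + p + q) fun j hj => ?_
  simp only [← PNat.coe_lt_coe, PNat.add_coe] at hj
  have hp : p < j := by rw [← PNat.coe_lt_coe]; omega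
  have hj1 := PNat.sub_one_add_one_of_lt hp
  have hj2 : ((j - 1 : ℕ+) : ℕ) + 1 = j := by rw [← PNat.one_coe, ← PNat.add_coe, hj1]
  have hp0 := p.pos
  have hNj : N < j - 1 := by rw [← PNat.coe_lt_coe]; omega
  have hq : q ≤ w (j - 1) := by rw [hN _ hNj, ← PNat.coe_le_coe]; omega
  rw [(h.2.2 j hp).2 hq, hN _ hNj, hj1]

theorem finSupp.mul_swap {w : Equiv.Perm ℕ+} (hw : finSupp w) (a b : ℕ+) :
    finSupp (w * Equiv.swap a b) := by
  obtain ⟨N, hN⟩ := hw.exists_bound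
  refine finSupp_of_bound (N := max N (max a b)) fun j hj => ?_
  simp only [max_lt_iff] at hj
  rw [Equiv.Perm.mul_apply, Equiv.swap_apply_of_ne_of_ne hj.2.1.ne' hj.2.2.ne', hN _ hj.1]

theorem finSupp.bruhatLE {u w : Equiv.Perm ℕ+} (hu : finSupp u) (h : bruhatLE u w) :
    finSupp w := by
  induction h with
  | refl => exact hu
  | tail _ hc ih =>
    obtain ⟨a, b, -, rfl, -⟩ := hc
    exact ih.mul_swap a b

theorem bruhatLE.len_le {u w : Equiv.Perm ℕ+} (h : bruhatLE u w) : len u ≤ len w := by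
  induction h with
  | refl => exact le_rfl
  | tail _ hc ih =>
    obtain ⟨a, b, -, -, h⟩ := hc
    omega

theorem finSupp.finite_inversions {w : Equiv.Perm ℕ+} (hw : finSupp w) :
    {p : ℕ+ × ℕ+ | p.1 < p.2 ∧ w p.2 < w p.1}.Finite := by
  obtain ⟨N, hN⟩ := hw.exists_bound
  refine ((Set.finite_Iic N).prod (Set.finite_Iic N)).subset ?_
  rintro ⟨i, j⟩ ⟨hij, hw'⟩
  simp only at hij hw'
  have hj : j ≤ N := by
    by_contra hj
    rw [not_le] at hj
    rw [hN j hj] at hw'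
    have := w.injective (hN _ (hj.trans hw'))
    rw [this] at hw'
    exact lt_asymm hij hw'
  exact ⟨hij.le.trans hj, hj⟩

theorem len_mul_swap {w : Equiv.Perm ℕ+} (hw : finSupp w) {c d : ℕ+} (hcd : c < d)
    (hlt : w c < w d) (hno : ∀ k, c < k → k < d → w c < w k → ¬ w k < w d) :
    len (w * Equiv.swap c d) = len w + 1 := by
  classical
  have hout : ∀ k, c < k → k < d → w k < w c ∨ w d < w k := fun k h1 h2 =>
    (lt_or_gt_of_ne (w.injective.ne h1.ne')).imp_right fun h =>
      lt_of_le_of_ne (not_lt.1 (hno k h1 h2 h)) (w.injective.ne h2.ne')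
  clear hno
  set s := Equiv.swap c d with hs
  have hss : ∀ i, s (s i) = i := Equiv.swap_apply_self c d
  have hsi : ∀ i, s i = if i = c then d else if i = d then c else i := fun i =>
    Equiv.swap_apply_def c d i
  let f : ℕ+ × ℕ+ → ℕ+ × ℕ+ := fun x => if s x.1 < s x.2 then (s x.1, s x.2) else x
  have key : {x : ℕ+ × ℕ+ | x.1 < x.2 ∧ (w * s) x.2 < (w * s) x.1}
      = insert (c, d) (f '' {x : ℕ+ × ℕ+ | x.1 < x.2 ∧ w x.2 < w x.1}) := by
    ext ⟨i, j⟩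
    simp only [Set.mem_ofPred_eq, Set.mem_insert_iff, Set.mem_image, Prod.exists, f,
      Equiv.Perm.mul_apply, Prod.mk.injEq]
    constructor
    · rintro ⟨h1, h2⟩
      by_cases h : i = c ∧ j = d
      · exact Or.inl h
      · right
        by_cases h3 : s i < s j
        · exact ⟨s i, s j, ⟨h3, h2⟩, by simp [hss, h1]⟩
        · refine ⟨i, j, ⟨h1, ?_⟩, by simp [h3]⟩
          grind
    · rintro (⟨rfl, rfl⟩ | ⟨a, b, ⟨h1, h2⟩, h3⟩)
      · simp [hs, hcd, hlt]
      · split_ifs at h3 with h4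
        · obtain ⟨rfl, rfl⟩ := h3
          exact ⟨h4, by simpa [hss] using h2⟩
        · obtain ⟨rfl, rfl⟩ := h3
          refine ⟨h1, ?_⟩
          grind
  have hinj : Set.InjOn f {x : ℕ+ × ℕ+ | x.1 < x.2 ∧ w x.2 < w x.1} := by
    refine Set.LeftInvOn.injOn (f₁' := f) ?_
    rintro ⟨i, j⟩ ⟨h1, -⟩
    simp only at h1
    by_cases h : s i < s j <;> simp [f, h, hss, h1]
  have hnot : (c, d) ∉ f '' {x : ℕ+ × ℕ+ | x.1 < x.2 ∧ w x.2 < w x.1} := by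
    rintro ⟨⟨i, j⟩, ⟨h1, h2⟩, h3⟩
    simp only [f] at h1 h2 h3
    split_ifs at h3 <;> grind
  rw [len, key, Set.ncard_insert_of_notMem hnot (hw.finite_inversions.image f),
    hinj.ncard_image, len]

theorem bruhatLE_mul_swap {w : Equiv.Perm ℕ+} (hw : finSupp w) {c d : ℕ+} (hcd : c < d)
    (hlt : w c < w d) : bruhatLE w (w * Equiv.swap c d) := by
  obtain ⟨n, hn⟩ : ∃ n : ℕ, (d : ℕ) < c + n := ⟨d + 1, by omega⟩
  induction n generalizing w c d with
  | zero => rw [← PNat.coe_lt_coe] at hcd; omega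
  | succ n ih =>
    by_cases hno : ∀ k, c < k → k < d → w c < w k → ¬ w k < w d
    · exact Relation.ReflTransGen.single ⟨c, d, hcd.ne, rfl, len_mul_swap hw hcd hlt hno⟩
    · push Not at hno
      obtain ⟨k, hck, hkd, h1, h2⟩ := hno
      have e : w * Equiv.swap c d
          = w * Equiv.swap c k * Equiv.swap k d * Equiv.swap c k := by
        rw [mul_assoc, mul_assoc, ← mul_assoc (Equiv.swap c k), Equiv.swap_comm k d,
          Equiv.swap_comm c k, Equiv.swap_mul_swap_mul_swap hkd.ne' hcd.ne']
      have hck' := PNat.coe_lt_coe _ _ |>.2 hck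
      have hkd' := PNat.coe_lt_coe _ _ |>.2 hkd
      rw [e]
      refine ((ih hw hck h1 (by omega)).trans (ih (hw.mul_swap _ _) hkd ?_ (by omega))).trans
        (ih ((hw.mul_swap _ _).mul_swap _ _) hck ?_ (by omega))
      · simpa [Equiv.swap_apply_of_ne_of_ne hcd.ne' hkd.ne'] using hlt
      · simpa [Equiv.swap_apply_of_ne_of_ne hcd.ne' hkd.ne',
          Equiv.swap_apply_of_ne_of_ne hck.ne hcd.ne] using h2

theorem lt_of_len_mul_swap {w : Equiv.Perm ℕ+} (hw : finSupp w) {a b : ℕ+} (hab : a < b)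
    (h : len (w * Equiv.swap a b) = len w + 1) : w a < w b := by
  by_contra hlt
  have hlt' : w b < w a := lt_of_le_of_ne (not_lt.1 hlt) (w.injective.ne hab.ne')
  have := (bruhatLE_mul_swap (hw.mul_swap a b) hab (by simpa using hlt')).len_le
  rw [mul_assoc, Equiv.swap_mul_self, mul_one] at this
  omega

/-- Lemma 4.1.1(i): `ε_{p,q}` preserves the Bruhat order. -/
theorem stmt16 (p q : ℕ+) (x z x' z' : Equiv.Perm ℕ+)
    (hx : finSupp x) (hz : finSupp z)
    (hx' : isEps p q x x') (hz' : isEps p q z z')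
    (hxz : bruhatLE x z) : bruhatLE x' z' := by
  clear hz
  induction hxz generalizing z' with
  | refl =>
    rw [hx'.right_unique hz']
    exact Relation.ReflTransGen.refl
  | @tail y z hxy hyz ih =>
    have hy : finSupp y := hx.bruhatLE hxy
    obtain ⟨a, b, hab, rfl, hlen⟩ := hyz
    wlog hlt : a < b generalizing a b
    · have hba : b < a := lt_of_le_of_ne (not_lt.1 hlt) hab.symm
      rw [Equiv.swap_comm] at hz' hlen
      exact this b a hab.symm hz' hlen hba
    have hy' := hz'.mul_swap a b
    rw [mul_assoc, Equiv.swap_mul_self, mul_one] at hy'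
    set y' := z' * Equiv.swap (skip p a) (skip p b) with hy'_def
    have e : z' = y' * Equiv.swap (skip p a) (skip p b) := by
      rw [hy'_def, mul_assoc, Equiv.swap_mul_self, mul_one]
    rw [e]
    refine (ih y' hy').trans (bruhatLE_mul_swap (hy.isEps hy') (skip_strictMono p hlt) ?_)
    rw [(isEps_iff.1 hy').2, (isEps_iff.1 hy').2]
    exact skip_strictMono q (lt_of_len_mul_swap hy hlt hlen)
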